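/- arXiv:2308.05783 — 3 statements merged into one kernel-verified Lean document; each statement's English description precedes it below -/
import Mathlib

section
/- Under the pivoted-QR hypotheses, every column aᵢ of the matrix B = P · [[R₁⁻¹ R₂], [−I]] satisfies aᵢᵀ Y = 0; equivalently, Bᵀ Y = 0, so every column of B lies in the left nullspace of the data matrix Y. -/
open Matrix

/-- Under the pivoted-QR hypotheses (`Yᵀ P = S R` with `P` a
permutation matrix, `S` orthogonal, `R = [[R₁, R₂], [0, 0]]`, `R₁` invertible and
upper triangular), every column of `B = P · [[R₁⁻¹ R₂], [−I]]` lies in the left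
nullspace of `Y`; equivalently `Bᵀ Y = 0`. Here the row index of `Y`
(of size `n = r + Nₙ`) is `Fin r ⊕ Fin Nₙ` and its column index
(of size `Nₛ = r + m`) is `Fin r ⊕ Fin m`. -/
theorem statement2 (r Nn m : ℕ)
    (Y : Matrix (Fin r ⊕ Fin Nn) (Fin r ⊕ Fin m) ℝ)
    (P : Matrix (Fin r ⊕ Fin Nn) (Fin r ⊕ Fin Nn) ℝ)
    (σ : Equiv.Perm (Fin r ⊕ Fin Nn)) (hP : P = σ.permMatrix ℝ)
    (S : Matrix (Fin r ⊕ Fin m) (Fin r ⊕ Fin m) ℝ) (hS : Sᵀ * S = 1)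
    (R₁ : Matrix (Fin r) (Fin r) ℝ) (hR₁ : IsUnit R₁)
    (hR₁tri : R₁.BlockTriangular id)
    (R₂ : Matrix (Fin r) (Fin Nn) ℝ)
    (hQR : Yᵀ * P = S * fromBlocks R₁ R₂ 0 0)
    (B : Matrix (Fin r ⊕ Fin Nn) (Fin Nn) ℝ)
    (hB : B = P * fromRows (R₁⁻¹ * R₂) (-1)) :
    Bᵀ * Y = 0 ∧ ∀ i : Fin Nn, (fun j => B j i) ᵥ* Y = 0 := by
  have hdet : IsUnit R₁.det := (isUnit_iff_isUnit_det R₁).mp hR₁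
  -- The products in `hQR` and `hB` elaborate to the definitionally equal `CStarMatrix` product.
  have hQR_matrix : Yᵀ * P =
      S * (fromBlocks R₁ R₂ 0 0 : Matrix (Fin r ⊕ Fin m) (Fin r ⊕ Fin Nn) ℝ) := hQR
  have hB_matrix : B =
      P * (fromRows (R₁⁻¹ * R₂) (-1) : Matrix (Fin r ⊕ Fin Nn) (Fin Nn) ℝ) := hB
  have hker : Yᵀ * B = 0 := by
    rw [hB_matrix, ← Matrix.mul_assoc, hQR_matrix, Matrix.mul_assoc, fromBlocks_mul_fromRows,
      mul_nonsing_inv_cancel_left _ _ hdet]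
    simp
  have hBY : Bᵀ * Y = 0 := by
    simpa using congrArg transpose hker
  refine ⟨hBY, fun i => ?_⟩
  ext k
  exact congrFun (congrFun hBY i) k
end

section
/- Under the pivoted-QR hypotheses, the rank of Y equals r, and every vector a ∈ ℝⁿ with aᵀ Y = 0 is a linear combination of the columns of B = P · [[R₁⁻¹ R₂], [−I]]. Consequently the columns of B form a basis of the left nullspace {a ∈ ℝⁿ : aᵀ Y = 0}, whose dimension is Nₙ = n − rank(Y). -/
open Matrix

/-- The kernel of `[[R₁, R₂], [0, 0]]` with `R₁` invertible is the column space of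
`[[R₁⁻¹ R₂], [-1]]`. -/
theorem fromBlocks_zero_zero_mulVec_eq_zero_iff {ι κ μ K : Type*} [Fintype ι] [DecidableEq ι]
    [Fintype κ] [DecidableEq κ] [Field K] {R₁ : Matrix ι ι K} (hR₁ : IsUnit R₁)
    (R₂ : Matrix ι κ K) (x : ι ⊕ κ → K) :
    fromBlocks R₁ R₂ (0 : Matrix μ ι K) 0 *ᵥ x = 0 ↔
      ∃ y, fromRows (R₁⁻¹ * R₂) (-1) *ᵥ y = x := by
  have hdet : IsUnit R₁.det := (isUnit_iff_isUnit_det R₁).1 hR₁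
  constructor
  · intro h
    have h₁ : R₁ *ᵥ (x ∘ Sum.inl) + R₂ *ᵥ (x ∘ Sum.inr) = 0 := by
      ext i
      simpa [fromBlocks_mulVec] using congrFun h (Sum.inl i)
    have h₂ : x ∘ Sum.inl = -((R₁⁻¹ * R₂) *ᵥ (x ∘ Sum.inr)) := by
      have := congrArg (R₁⁻¹ *ᵥ ·) h₁
      simp only [mulVec_add, mulVec_mulVec, nonsing_inv_mul _ hdet, one_mulVec,
        mulVec_zero] at this
      exact eq_neg_of_add_eq_zero_left this
    refine ⟨-(x ∘ Sum.inr), ?_⟩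
    rw [fromRows_mulVec, mulVec_neg, ← h₂, neg_mulVec_neg, one_mulVec]
    exact Sum.elim_comp_inl_inr x
  · rintro ⟨y, rfl⟩
    rw [mulVec_mulVec, fromBlocks_mul_fromRows, mul_nonsing_inv_cancel_left _ _ hdet]
    simp

/-- A matrix of the form `[[A], [-1]]` has injective `mulVec`. -/
theorem fromRows_neg_one_mulVec_injective {ι κ K : Type*}
    [Fintype κ] [DecidableEq κ] [Ring K] (A : Matrix ι κ K) :
    Function.Injective (fromRows A (-1 : Matrix κ κ K)).mulVec := by
  intro y z h
  ext i
  simpa [fromRows_mulVec, neg_mulVec] using congrFun h (Sum.inr i)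

/-- Under the pivoted-QR hypotheses (`Yᵀ P = S R` with `P` a
permutation matrix, `S` orthogonal, `R = [[R₁, R₂], [0, 0]]`, `R₁` invertible and
upper triangular), the rank of `Y` equals `r`, every left-nullspace vector of `Y`
is a linear combination of the columns of `B = P · [[R₁⁻¹ R₂], [−I]]`, and the
columns of `B` form a basis of the left nullspace, whose dimension is
`Nₙ = n − rank Y`. Here the row index of `Y`
(of size `n = r + Nₙ`) is `Fin r ⊕ Fin Nₙ` and its column index
(of size `Nₛ = r + m`) is `Fin r ⊕ Fin m`. -/
theorem statement4 (r Nn m : ℕ)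
    (Y : Matrix (Fin r ⊕ Fin Nn) (Fin r ⊕ Fin m) ℝ)
    (P : Matrix (Fin r ⊕ Fin Nn) (Fin r ⊕ Fin Nn) ℝ)
    (σ : Equiv.Perm (Fin r ⊕ Fin Nn)) (hP : P = σ.permMatrix ℝ)
    (S : Matrix (Fin r ⊕ Fin m) (Fin r ⊕ Fin m) ℝ) (hS : Sᵀ * S = 1)
    (R₁ : Matrix (Fin r) (Fin r) ℝ) (hR₁ : IsUnit R₁)
    (hR₁tri : R₁.BlockTriangular id)
    (R₂ : Matrix (Fin r) (Fin Nn) ℝ)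
    (hQR : Yᵀ * P = S * fromBlocks R₁ R₂ 0 0)
    (B : Matrix (Fin r ⊕ Fin Nn) (Fin Nn) ℝ)
    (hB : B = P * fromRows (R₁⁻¹ * R₂) (-1)) :
    Y.rank = r ∧
    (∀ a : Fin r ⊕ Fin Nn → ℝ, a ᵥ* Y = 0 →
      a ∈ Submodule.span ℝ (Set.range fun i : Fin Nn => (fun j => B j i))) ∧
    (Submodule.span ℝ (Set.range fun i : Fin Nn => (fun j => B j i)) :
        Set (Fin r ⊕ Fin Nn → ℝ)) = {a | a ᵥ* Y = 0} ∧
    Module.finrank ℝ (LinearMap.ker Y.vecMulLinear) = Nn := by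
  have hQR' : Yᵀ * P =
      S * (fromBlocks R₁ R₂ 0 0 : Matrix (Fin r ⊕ Fin m) (Fin r ⊕ Fin Nn) ℝ) := hQR
  have hB' : B = P * fromRows (R₁⁻¹ * R₂) (-1 : Matrix (Fin Nn) (Fin Nn) ℝ) := hB
  have hPP : P * Pᵀ = 1 := by
    rw [hP, transpose_permMatrix, ← permMatrix_mul]
    simp
  have hPP' : Pᵀ * P = 1 := mul_eq_one_comm.1 hPP
  have hker : ∀ a : Fin r ⊕ Fin Nn → ℝ, a ᵥ* Y = 0 ↔ ∃ y, B *ᵥ y = a := by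
    intro a
    have ha : P *ᵥ (Pᵀ *ᵥ a) = a := by rw [mulVec_mulVec, hPP, one_mulVec]
    have h₁ : a ᵥ* Y = S *ᵥ (fromBlocks R₁ R₂ 0 0 *ᵥ (Pᵀ *ᵥ a)) := by
      rw [mulVec_mulVec, ← hQR', ← mulVec_mulVec, ha, mulVec_transpose]
    have hSz : ∀ z, S *ᵥ z = 0 ↔ z = 0 := fun z =>
      ⟨fun h => by simpa [hS] using congrArg (Sᵀ *ᵥ ·) h, fun h => by rw [h, mulVec_zero]⟩
    rw [h₁, hSz, fromBlocks_zero_zero_mulVec_eq_zero_iff hR₁]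
    refine exists_congr fun y => ?_
    rw [hB', ← mulVec_mulVec]
    constructor
    · intro h
      rw [h, ha]
    · rintro rfl
      rw [mulVec_mulVec, hPP', one_mulVec]
  have hspan : Submodule.span ℝ (Set.range fun i : Fin Nn => (fun j => B j i)) =
      LinearMap.range B.mulVecLin := (range_mulVecLin B).symm
  have hrange : LinearMap.ker Y.vecMulLinear = LinearMap.range B.mulVecLin := by
    ext a
    simpa using hker a
  have hinj : Function.Injective B.mulVecLin := by
    intro y z h
    apply fromRows_neg_one_mulVec_injective (R₁⁻¹ * R₂)
    have := congrArg (Pᵀ *ᵥ ·) h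
    simpa only [mulVecLin_apply, hB', mulVec_mulVec, ← Matrix.mul_assoc, hPP',
      Matrix.one_mul] using this
  have hfin : Module.finrank ℝ (LinearMap.ker Y.vecMulLinear) = Nn := by
    rw [hrange, LinearMap.finrank_range_of_inj hinj, Module.finrank_fin_fun]
  refine ⟨?_, fun a ha => ?_, ?_, hfin⟩
  · have h := Y.vecMulLinear.finrank_range_add_finrank_ker
    have hY : Y.vecMulLinear = Yᵀ.mulVecLin := by
      ext
      simp
    rw [hfin, hY, Module.finrank_fintype_fun_eq_card, Fintype.card_sum, Fintype.card_fin,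
      Fintype.card_fin] at h
    rw [← rank_transpose, Matrix.rank]
    omega
  · rw [hspan]
    exact (hker a).1 ha
  · rw [hspan]
    ext a
    exact (hker a).symm
end

section
/- (Completeness of AutoTight, cost part.) Let 𝒜ₖ be any set of valid constraints for V (so 𝒜ₖ ⊆ 𝒜ₗ, where 𝒜ₗ = {A symmetric : xᵀ A x = 0 for all x ∈ V} is the learned constraint set), assume V is nonempty, and assume the set {⟨Q, X⟩ : X ∈ F(𝒜ₖ)} is bounded below. Then p(𝒜ₖ) ≤ p(𝒜ₗ) ≤ q⋆; in particular, if the relaxation with constraints 𝒜ₖ is cost-tight, i.e. q⋆ = p(𝒜ₖ), then the relaxation with the learned constraints is also cost-tight: q⋆ = p(𝒜ₗ). -/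
open Matrix

noncomputable section

/-- `A₀ = e₁ e₁ᵀ`, where `e₁` is the first standard basis vector of `ℝ^N`. -/
def A0 (N : ℕ) : Matrix (Fin N) (Fin N) ℝ :=
  Matrix.of fun i j => (if (i : ℕ) = 0 then (1 : ℝ) else 0) * (if (j : ℕ) = 0 then 1 else 0)

/-- The QCQP feasible set `V = {x : xᵀ A₀ x = 1 ∧ ∀ A ∈ 𝒜ₚ, xᵀ A x = 0}`. -/
def Vfeas (N : ℕ) (Ap : Set (Matrix (Fin N) (Fin N) ℝ)) : Set (Fin N → ℝ) :=
  {x | x ⬝ᵥ A0 N *ᵥ x = 1 ∧ ∀ A ∈ Ap, x ⬝ᵥ A *ᵥ x = 0}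

/-- The QCQP optimal value `q⋆ = inf {xᵀ Q x : x ∈ V}`. -/
def qcqpVal (N : ℕ) (Q : Matrix (Fin N) (Fin N) ℝ)
    (Ap : Set (Matrix (Fin N) (Fin N) ℝ)) : ℝ :=
  sInf ((fun x => x ⬝ᵥ Q *ᵥ x) '' Vfeas N Ap)

/-- The SDP feasible set
`F(𝒜) = {X ⪰ 0 : ⟨A₀, X⟩ = 1 ∧ ∀ A ∈ 𝒜, ⟨A, X⟩ = 0}` (Frobenius inner product);
note that `X.PosSemidef` includes the symmetry of `X`. -/
def Fset (N : ℕ) (𝒜 : Set (Matrix (Fin N) (Fin N) ℝ)) :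
    Set (Matrix (Fin N) (Fin N) ℝ) :=
  {X | X.PosSemidef ∧ ((A0 N)ᵀ * X).trace = 1 ∧ ∀ A ∈ 𝒜, (Aᵀ * X).trace = 0}

/-- The SDP optimal value `p(𝒜) = inf {⟨Q, X⟩ : X ∈ F(𝒜)}`. -/
def sdpVal (N : ℕ) (Q : Matrix (Fin N) (Fin N) ℝ)
    (𝒜 : Set (Matrix (Fin N) (Fin N) ℝ)) : ℝ :=
  sInf ((fun X => (Qᵀ * X).trace) '' Fset N 𝒜)

/-- The learned constraint set `𝒜ₗ = {A symmetric : ∀ x ∈ V, xᵀ A x = 0}`. -/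
def Alearned (N : ℕ) (Ap : Set (Matrix (Fin N) (Fin N) ℝ)) :
    Set (Matrix (Fin N) (Fin N) ℝ) :=
  {A | A.IsSymm ∧ ∀ x ∈ Vfeas N Ap, x ⬝ᵥ A *ᵥ x = 0}

/-- The lift `x ↦ x xᵀ` turns a quadratic form into a Frobenius inner product. -/
theorem trace_transpose_mul_vecMulVec_self {n R : Type*} [Fintype n] [CommSemiring R]
    (M : Matrix n n R) (x : n → R) :
    (Mᵀ * vecMulVec x x).trace = x ⬝ᵥ M *ᵥ x := by
  rw [mul_vecMulVec, trace_vecMulVec, mulVec_transpose, ← dotProduct_mulVec]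

theorem Fset_anti (N : ℕ) {𝒜 ℬ : Set (Matrix (Fin N) (Fin N) ℝ)} (h : 𝒜 ⊆ ℬ) :
    Fset N ℬ ⊆ Fset N 𝒜 :=
  fun _ hX => ⟨hX.1, hX.2.1, fun A hA => hX.2.2 A (h hA)⟩

theorem vecMulVec_self_mem_Fset_Alearned {N : ℕ} {Ap : Set (Matrix (Fin N) (Fin N) ℝ)}
    {x : Fin N → ℝ} (hx : x ∈ Vfeas N Ap) :
    vecMulVec x x ∈ Fset N (Alearned N Ap) := by
  refine ⟨by simpa using posSemidef_vecMulVec_self_star x, ?_, fun A hA => ?_⟩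
  · rw [trace_transpose_mul_vecMulVec_self]
    exact hx.1
  · rw [trace_transpose_mul_vecMulVec_self]
    exact hA.2 x hx

/-- **Completeness of AutoTight, cost part.** If `𝒜ₖ` is any set of
valid constraints for `V` (i.e. `𝒜ₖ ⊆ 𝒜ₗ`, the learned constraint set), `V` is
nonempty and the SDP objective is bounded below on `F(𝒜ₖ)`, then
`p(𝒜ₖ) ≤ p(𝒜ₗ) ≤ q⋆`; in particular cost-tightness with `𝒜ₖ` implies
cost-tightness with the learned constraints `𝒜ₗ`. -/
theorem statement11 (N : ℕ) (hN : 1 ≤ N)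
    (Ap : Set (Matrix (Fin N) (Fin N) ℝ))
    (Q : Matrix (Fin N) (Fin N) ℝ) (hQ : Q.IsSymm)
    (Ak : Set (Matrix (Fin N) (Fin N) ℝ)) (hAk : Ak ⊆ Alearned N Ap)
    (hV : (Vfeas N Ap).Nonempty)
    (hbdd : BddBelow ((fun X => (Qᵀ * X).trace) '' Fset N Ak)) :
    sdpVal N Q Ak ≤ sdpVal N Q (Alearned N Ap) ∧
    sdpVal N Q (Alearned N Ap) ≤ qcqpVal N Q Ap ∧
    (qcqpVal N Q Ap = sdpVal N Q Ak →
      qcqpVal N Q Ap = sdpVal N Q (Alearned N Ap)) := by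
  have hsub := Set.image_mono (f := fun X => (Qᵀ * X).trace) (Fset_anti N hAk)
  have hlift : (fun x => x ⬝ᵥ Q *ᵥ x) '' Vfeas N Ap ⊆
      (fun X => (Qᵀ * X).trace) '' Fset N (Alearned N Ap) := by
    rintro _ ⟨x, hx, rfl⟩
    exact ⟨_, vecMulVec_self_mem_Fset_Alearned hx, trace_transpose_mul_vecMulVec_self Q x⟩
  have hVQ := hV.image (fun x => x ⬝ᵥ Q *ᵥ x)
  have hkl : sdpVal N Q Ak ≤ sdpVal N Q (Alearned N Ap) :=
    csInf_le_csInf hbdd (hVQ.mono hlift) hsub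
  have hlq : sdpVal N Q (Alearned N Ap) ≤ qcqpVal N Q Ap :=
    csInf_le_csInf (hbdd.mono hsub) hVQ hlift
  exact ⟨hkl, hlq, fun h => le_antisymm (h.trans_le hkl) hlq⟩
end
end
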